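/- arXiv:1306.3557 — 2 statements merged into one kernel-verified Lean document; each statement's English description precedes it below -/
import Mathlib

section
/- Let V and W be unitary operators on a complex Hilbert space H₀ satisfying W² = −I and VW = WV⁻¹. If s and r are positive real numbers with s² + r² = 1, then the linear combination U = sV + rW is a unitary operator on H₀. -/
/-- If `V`, `W` are unitary operators on a complex Hilbert space satisfying
`W² = −I` and `VW = WV⁻¹` (equivalently, `VWV = W`), and `s, r > 0` with `s² + r² = 1`,
then `U = sV + rW` is unitary. -/
theorem linear_combination_unitary
    {H₀ : Type*} [NormedAddCommGroup H₀] [InnerProductSpace ℂ H₀] [CompleteSpace H₀]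
    (V W : H₀ →L[ℂ] H₀)
    (hV : V ∈ unitary (H₀ →L[ℂ] H₀)) (hW : W ∈ unitary (H₀ →L[ℂ] H₀))
    (hW2 : W * W = -1)
    (hVW : V * W * V = W)  -- `VW = WV⁻¹`
    (s r : ℝ) (hs : 0 < s) (hr : 0 < r) (hsr : s ^ 2 + r ^ 2 = 1) :
    (s : ℂ) • V + (r : ℂ) • W ∈ unitary (H₀ →L[ℂ] H₀) := by
  obtain ⟨hV₁, hV₂⟩ := Unitary.mem_iff.mp hV
  obtain ⟨hW₁, hW₂⟩ := Unitary.mem_iff.mp hW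
  have hWstar : star W = -W := by
    calc star W = -(star W * (W * W)) := by rw [hW2]; simp
      _ = -W := by rw [← mul_assoc, hW₁, one_mul]
  have hleft : star V * W = W * V := by
    calc star V * W = star V * (V * W * V) := by rw [hVW]
      _ = star V * V * (W * V) := by simp only [mul_assoc]
      _ = W * V := by rw [hV₁, one_mul]
  have hright : W * star V = V * W := by
    calc W * star V = V * W * V * star V := by rw [hVW]
      _ = V * W := by rw [mul_assoc, hV₂, mul_one]
  have hsr' : (s : ℂ) * s + r * r = 1 := by
    rw [← sq, ← sq]
    exact_mod_cast hsr
  have hstar : star ((s : ℂ) • V + (r : ℂ) • W) = (s : ℂ) • star V - (r : ℂ) • W := by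
    simp [star_add, star_smul, hWstar, sub_eq_add_neg]
  rw [Unitary.mem_iff, hstar]
  constructor
  · calc ((s : ℂ) • star V - (r : ℂ) • W) * ((s : ℂ) • V + (r : ℂ) • W)
        = ((s : ℂ) * s + r * r) • (1 : H₀ →L[ℂ] H₀) := by
          simp only [sub_mul, mul_add, smul_mul_smul_comm, hV₁, hW2, hleft]
          module
      _ = 1 := by rw [hsr', one_smul]
  · calc ((s : ℂ) • V + (r : ℂ) • W) * ((s : ℂ) • star V - (r : ℂ) • W)
        = ((s : ℂ) * s + r * r) • (1 : H₀ →L[ℂ] H₀) := by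
          simp only [add_mul, mul_sub, smul_mul_smul_comm, hV₂, hW2, hright]
          module
      _ = 1 := by rw [hsr', one_smul]
end

section
/- Let V and W be unitary operators on a complex Hilbert space H₀ satisfying W² = −I and VW = WV⁻¹, let s, r > 0 with s² + r² = 1, and set U = sV + rW. Define the bounded operators x = (s/2)(V* + V), y = (s/2i)(V − V*), and w = rW. Then for every integer n ≥ 1, the n-th power of U is given by Uⁿ = T_n(x) + (iy + w)·U_{n−1}(x), where T_n and U_{n−1} denote the Chebyshev polynomials of the first kind of degree n and of the second kind of degree n−1, evaluated at the operator x. -/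
open Polynomial ContinuousLinearMap

/-- If `u` satisfies `u² = 2ux − 1`, then `uⁿ = Tₙ(x) + (u − x)·Uₙ₋₁(x)`. -/
theorem pow_eq_aeval_chebyshev_T_add_mul_aeval_chebyshev_U
    {R A : Type*} [CommRing R] [Ring A] [Algebra R A] {u x : A}
    (h : u * u = u * (2 * x) - 1) (n : ℕ) :
    u ^ n = aeval x (Chebyshev.T R (n : ℤ)) + (u - x) * aeval x (Chebyshev.U R ((n : ℤ) - 1)) := by
  have key : ∀ k : ℕ, u ^ k =
      u * aeval x (Chebyshev.U R ((k : ℤ) - 1)) - aeval x (Chebyshev.U R ((k : ℤ) - 2)) := by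
    intro k
    induction k with
    | zero => simp
    | succ k ih =>
      have hU := congrArg (aeval x) (Chebyshev.U_eq R (k : ℤ))
      simp only [map_sub, map_mul, aeval_X, map_ofNat] at hU
      have e₁ : ((k + 1 : ℕ) : ℤ) - 1 = k := by push_cast; ring
      have e₂ : ((k + 1 : ℕ) : ℤ) - 2 = k - 1 := by push_cast; ring
      rw [e₁, e₂, pow_succ', ih, mul_sub, ← mul_assoc u u, h, hU]
      noncomm_ring
  have hT := congrArg (aeval x) (Chebyshev.T_eq_U_sub_X_mul_U R (n : ℤ))
  have hU := congrArg (aeval x) (Chebyshev.U_eq R (n : ℤ))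
  simp only [map_sub, map_mul, aeval_X, map_ofNat] at hT hU
  rw [key, hT, hU]
  noncomm_ring

/-- **Chebyshev expansion of powers (Tate).** If `V`, `W` are unitaries on a complex
Hilbert space with `W² = −I` and `VW = WV⁻¹` (equivalently `VWV = W`), `s, r > 0`,
`s² + r² = 1`, and `U = sV + rW`, then with `x = (s/2)(V* + V)`, `y = (s/2i)(V − V*)`,
`w = rW`, one has `Uⁿ = Tₙ(x) + (iy + w)·U_{n−1}(x)` for all `n ≥ 1`, where `Tₙ`, `U_{n−1}`
are the Chebyshev polynomials of the first and second kind. -/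
theorem pow_eq_chebyshev
    {H₀ : Type*} [NormedAddCommGroup H₀] [InnerProductSpace ℂ H₀] [CompleteSpace H₀]
    (V W : H₀ →L[ℂ] H₀)
    (hV : V ∈ unitary (H₀ →L[ℂ] H₀)) (hW : W ∈ unitary (H₀ →L[ℂ] H₀))
    (hW2 : W * W = -1)
    (hVW : V * W * V = W)
    (s r : ℝ) (hs : 0 < s) (hr : 0 < r) (hsr : s ^ 2 + r ^ 2 = 1) :
    ∀ n : ℕ, 1 ≤ n →
      ((s : ℂ) • V + (r : ℂ) • W) ^ n =
        Polynomial.aeval (((s : ℂ) / 2) • (ContinuousLinearMap.adjoint V + V))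
            (Polynomial.Chebyshev.T ℂ (n : ℤ)) +
          (Complex.I • (((s : ℂ) / (2 * Complex.I)) • (V - ContinuousLinearMap.adjoint V)) +
            (r : ℂ) • W) *
          Polynomial.aeval (((s : ℂ) / 2) • (ContinuousLinearMap.adjoint V + V))
            (Polynomial.Chebyshev.U ℂ ((n : ℤ) - 1)) := by
  intro n _
  have hVV : V * adjoint V = 1 := Unitary.mul_star_self_of_mem hV
  have hWV : W * adjoint V = V * W := by
    calc W * adjoint V = V * W * V * adjoint V := by rw [hVW]
      _ = V * W := by rw [mul_assoc, hVV, mul_one]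
  set x := ((s : ℂ) / 2) • (adjoint V + V) with hx
  have hsub : Complex.I • (((s : ℂ) / (2 * Complex.I)) • (V - adjoint V)) + (r : ℂ) • W =
      ((s : ℂ) • V + (r : ℂ) • W) - x := by
    have hI : Complex.I * ((s : ℂ) / (2 * Complex.I)) = (s : ℂ) / 2 := by
      field_simp
    rw [hx, smul_smul, hI]
    module
  rw [hsub]
  apply pow_eq_aeval_chebyshev_T_add_mul_aeval_chebyshev_U
  have h2x : 2 * x = (s : ℂ) • (adjoint V + V) := by
    rw [hx, two_mul]
    module
  have hsr' : (1 : H₀ →L[ℂ] H₀) = ((s : ℂ) ^ 2 + (r : ℂ) ^ 2) • 1 := by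
    rw [show (s : ℂ) ^ 2 + (r : ℂ) ^ 2 = 1 by exact_mod_cast hsr, one_smul]
  rw [h2x, hsr']
  simp only [add_mul, mul_add, smul_mul_assoc, mul_smul_comm, smul_add, hVV, hWV, hW2]
  module
end
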